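/- arXiv:2407.05946 — 2 statements merged into one kernel-verified Lean document; each statement's English description precedes it below -/
import Mathlib

section
/- Let G₁ and G₂ be two compact generators of a triangulated category T with coproducts. Then there exists a positive integer M such that G₁ ∈ ⟨G₂⟩^{(-M,M)} and G₂ ∈ ⟨G₁⟩^{(-M,M)}, where ⟨G⟩^{(m,n)} denotes the thick closure of finite extensions of finite direct sums of shifts G[i] with m ≤ -i ≤ n. -/
open CategoryTheory CategoryTheory.Limits CategoryTheory.Pretriangulated

universe w v u

section Compact

variable {T : Type u} [Category.{v} T] [Preadditive T]

/-- The canonical comparison map `⨁ᵢ Hom(C, Xᵢ) →+ Hom(C, ∐ᵢ Xᵢ)`. -/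
noncomputable def compactComparison (C : T) {ι : Type w} [DecidableEq ι] (X : ι → T)
    [HasCoproduct X] : (DirectSum ι fun i => (C ⟶ X i)) →+ (C ⟶ ∐ X) :=
  DirectSum.toAddMonoid fun i => Preadditive.rightComp C (Sigma.ι X i)

/-- An object `C` is compact if for every small family `X` whose coproduct exists, the canonical
map `⨁ᵢ Hom(C, Xᵢ) → Hom(C, ∐ᵢ Xᵢ)` is an isomorphism (i.e. bijective). -/
def IsCompactObject (C : T) : Prop :=
  ∀ (ι : Type w) [DecidableEq ι] (X : ι → T) [HasCoproduct X],
    Function.Bijective (compactComparison C X)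

end Compact

variable {T : Type u} [Category.{v} T] [Preadditive T] [HasZeroObject T] [HasShift T ℤ]
  [∀ n : ℤ, (shiftFunctor T n).Additive] [Pretriangulated T]
variable [HasCoproducts.{v} T] [HasBinaryBiproducts T]

/-- `⟨G⟩^{(m,n)} = Smr(COprod(G[m,n]))`: the smallest strictly full subcategory containing
`G[i]` for `m ≤ -i ≤ n`, closed under extensions, finite direct sums and direct summands. -/
def genWindow (G : T) (m n : ℤ) : Set T :=
  ⋂₀ {S : Set T |
    (∀ i : ℤ, m ≤ -i → -i ≤ n → G⟦i⟧ ∈ S) ∧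
    (∀ X Y : T, X ∈ S → (X ≅ Y) → Y ∈ S) ∧
    (∀ Tr : Triangle T, Tr ∈ (distTriang T) → Tr.obj₁ ∈ S → Tr.obj₃ ∈ S → Tr.obj₂ ∈ S) ∧
    (∀ X Y : T, X ∈ S → Y ∈ S → (X ⊞ Y) ∈ S) ∧
    (∀ X Y : T, (X ⊞ Y) ∈ S → X ∈ S)}

/-- `Smr(Coprod(G[-∞,∞]))`: the smallest strictly full subcategory containing all shifts of
`G`, closed under extensions, small coproducts and direct summands. -/
def genAllCoprod (G : T) : Set T :=
  ⋂₀ {S : Set T |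
    (∀ i : ℤ, G⟦i⟧ ∈ S) ∧
    (∀ X Y : T, X ∈ S → (X ≅ Y) → Y ∈ S) ∧
    (∀ Tr : Triangle T, Tr ∈ (distTriang T) → Tr.obj₁ ∈ S → Tr.obj₃ ∈ S → Tr.obj₂ ∈ S) ∧
    (∀ (ι : Type v) (X : ι → T), (∀ i, X i ∈ S) → (∐ X) ∈ S) ∧
    (∀ X Y : T, (X ⊞ Y) ∈ S → X ∈ S)}

/-- `G` is a compact generator of `T`: `G` is compact and `T = Smr(Coprod(G[-∞,∞]))`. -/
def IsCompactGenerator (G : T) : Prop :=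
  IsCompactObject.{v} G ∧ genAllCoprod G = Set.univ

section CompactGeneration

variable {𝒯 : Type u} [Category.{v} 𝒯] [Preadditive 𝒯]

section Support

variable [HasCoproducts.{v} 𝒯]

open Classical in
/-- The idempotent of `∐ X` projecting onto the summands indexed by `s`. -/
noncomputable def sigmaTruncation {ι : Type v} (X : ι → 𝒯) (s : Finset ι) : ∐ X ⟶ ∐ X :=
  Sigma.desc fun i => if i ∈ s then Sigma.ι X i else 0

/-- Every morphism from `C` to a coproduct is supported on finitely many summands. -/
def HasFiniteSupport (C : 𝒯) : Prop :=
  ∀ (ι : Type v) (X : ι → 𝒯) (f : C ⟶ ∐ X), ∃ s : Finset ι, f ≫ sigmaTruncation X s = f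

open Classical in
lemma ι_sigmaTruncation {ι : Type v} (X : ι → 𝒯) (s : Finset ι) (i : ι) :
    Sigma.ι X i ≫ sigmaTruncation X s = if i ∈ s then Sigma.ι X i else 0 := by
  simp [sigmaTruncation]

lemma sigmaTruncation_comp_of_subset {ι : Type v} (X : ι → 𝒯) {s t : Finset ι} (h : s ⊆ t) :
    sigmaTruncation X s ≫ sigmaTruncation X t = sigmaTruncation X s := by
  classical
  refine Sigma.hom_ext _ _ fun i => ?_
  rw [← Category.assoc, ι_sigmaTruncation]
  split_ifs with hi
  · simp [ι_sigmaTruncation, h hi]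
  · simp

lemma comp_sigmaTruncation_of_subset {C : 𝒯} {ι : Type v} {X : ι → 𝒯} {s t : Finset ι} (h : s ⊆ t)
    {f : C ⟶ ∐ X} (hf : f ≫ sigmaTruncation X s = f) : f ≫ sigmaTruncation X t = f := by
  rw [← hf, Category.assoc, sigmaTruncation_comp_of_subset X h]

lemma IsCompactObject.hasFiniteSupport {C : 𝒯} (hC : IsCompactObject.{v} C) :
    HasFiniteSupport C := by
  classical
  intro ι X f
  obtain ⟨x, rfl⟩ := (hC ι X).2 f
  induction x using DirectSum.induction_on with
  | zero => exact ⟨∅, by simp⟩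
  | of i g =>
    refine ⟨{i}, ?_⟩
    simp [compactComparison, Preadditive.rightComp, ι_sigmaTruncation]
  | add x y hx hy =>
    obtain ⟨s, hs⟩ := hx
    obtain ⟨t, ht⟩ := hy
    refine ⟨s ∪ t, ?_⟩
    rw [map_add, Preadditive.add_comp,
      comp_sigmaTruncation_of_subset Finset.subset_union_left hs,
      comp_sigmaTruncation_of_subset Finset.subset_union_right ht]

lemma HasFiniteSupport.of_retract {X Y : 𝒯} (hY : HasFiniteSupport Y) (i : X ⟶ Y) (r : Y ⟶ X)
    (h : i ≫ r = 𝟙 X) : HasFiniteSupport X := by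
  intro ι Z f
  obtain ⟨s, hs⟩ := hY ι Z (r ≫ f)
  refine ⟨s, ?_⟩
  simpa [reassoc_of% h] using i ≫= hs

lemma HasFiniteSupport.shift [HasShift 𝒯 ℤ] {C : 𝒯} (hC : HasFiniteSupport C) (n : ℤ) :
    HasFiniteSupport (C⟦n⟧) := by
  classical
  intro ι X f
  let G : 𝒯 ⥤ 𝒯 := shiftFunctor 𝒯 (-n)
  let adj : shiftFunctor 𝒯 n ⊣ G := (shiftEquiv 𝒯 n).toAdjunction
  let φ : ∐ (fun i => G.obj (X i)) ⟶ G.obj (∐ X) := sigmaComparison G X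
  obtain ⟨s, hs⟩ := hC ι (fun i => G.obj (X i)) (adj.homEquiv _ _ f ≫ inv φ)
  have : G.PreservesZeroMorphisms := inferInstance
  have hφ : sigmaTruncation (fun i => G.obj (X i)) s ≫ φ = φ ≫ G.map (sigmaTruncation X s) := by
    refine Sigma.hom_ext _ _ fun i => ?_
    rw [← Category.assoc, ι_sigmaTruncation, ι_comp_sigmaComparison_assoc, ← G.map_comp,
      ι_sigmaTruncation]
    split_ifs <;> simp [φ]
  refine ⟨s, (adj.homEquiv _ _).injective ?_⟩
  rw [adj.homEquiv_naturality_right]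
  have h := hs =≫ φ
  simpa [hφ] using h

end Support

variable [HasZeroObject 𝒯] [HasShift 𝒯 ℤ] [∀ n : ℤ, (shiftFunctor 𝒯 n).Additive]
  [Pretriangulated 𝒯]

lemma HasFiniteSupport.of_distTriang [HasCoproducts.{v} 𝒯] {Tr : Triangle 𝒯}
    (hTr : Tr ∈ distTriang 𝒯)
    (h₁ : HasFiniteSupport Tr.obj₁) (h₃ : HasFiniteSupport Tr.obj₃) :
    HasFiniteSupport Tr.obj₂ := by
  classical
  intro ι X f
  obtain ⟨s, hs⟩ := h₁ ι X (Tr.mor₁ ≫ f)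
  obtain ⟨g, hg⟩ := Triangle.yoneda_exact₂ Tr hTr (f - f ≫ sigmaTruncation X s) (by
    rw [Preadditive.comp_sub, ← Category.assoc, hs, sub_self])
  obtain ⟨t, ht⟩ := h₃ ι X g
  refine ⟨s ∪ t, ?_⟩
  have hf : f = f ≫ sigmaTruncation X s + Tr.mor₂ ≫ g := by rw [← hg]; abel
  have h₁ : (f ≫ sigmaTruncation X s) ≫ sigmaTruncation X (s ∪ t) = f ≫ sigmaTruncation X s := by
    rw [Category.assoc, sigmaTruncation_comp_of_subset X Finset.subset_union_left]
  have h₂ : (Tr.mor₂ ≫ g) ≫ sigmaTruncation X (s ∪ t) = Tr.mor₂ ≫ g := by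
    rw [Category.assoc, comp_sigmaTruncation_of_subset Finset.subset_union_right ht]
  rw [hf, Preadditive.add_comp, h₁, h₂]

variable [HasBinaryBiproducts 𝒯]

lemma genWindow_shift (G : 𝒯) {m n i : ℤ} (h₁ : m ≤ -i) (h₂ : -i ≤ n) :
    G⟦i⟧ ∈ genWindow G m n :=
  fun _ hS => hS.1 i h₁ h₂

lemma genWindow_iso {G : 𝒯} {m n : ℤ} {X Y : 𝒯} (hX : X ∈ genWindow G m n) (e : X ≅ Y) :
    Y ∈ genWindow G m n :=
  fun S hS => hS.2.1 X Y (hX S hS) e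

lemma genWindow_ext {G : 𝒯} {m n : ℤ} {Tr : Triangle 𝒯} (hTr : Tr ∈ distTriang 𝒯)
    (h₁ : Tr.obj₁ ∈ genWindow G m n) (h₃ : Tr.obj₃ ∈ genWindow G m n) :
    Tr.obj₂ ∈ genWindow G m n :=
  fun S hS => hS.2.2.1 Tr hTr (h₁ S hS) (h₃ S hS)

lemma genWindow_biprod {G : 𝒯} {m n : ℤ} {X Y : 𝒯} (hX : X ∈ genWindow G m n)
    (hY : Y ∈ genWindow G m n) : (X ⊞ Y) ∈ genWindow G m n :=
  fun S hS => hS.2.2.2.1 X Y (hX S hS) (hY S hS)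

lemma genWindow_of_biprod {G : 𝒯} {m n : ℤ} {X Y : 𝒯} (h : (X ⊞ Y) ∈ genWindow G m n) :
    X ∈ genWindow G m n :=
  fun S hS => hS.2.2.2.2 X Y (h S hS)

lemma genWindow_mono (G : 𝒯) {m n m' n' : ℤ} (hm : m' ≤ m) (hn : n ≤ n') :
    genWindow G m n ⊆ genWindow G m' n' :=
  fun _ hX S hS => hX S ⟨fun i h₁ h₂ => hS.1 i (hm.trans h₁) (h₂.trans hn), hS.2⟩

lemma genWindow_of_retract {G : 𝒯} {m n : ℤ} {X Y : 𝒯} (hY : Y ∈ genWindow G m n) (i : X ⟶ Y)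
    (r : Y ⟶ X) (h : i ≫ r = 𝟙 X) : X ∈ genWindow G m n := by
  obtain ⟨Z, p, d, hT⟩ := distinguished_cocone_triangle i
  have : IsSplitMono i := ⟨⟨⟨r, h⟩⟩⟩
  have hd : d = 0 := Triangle.mor₃_eq_zero_of_mono₁ _ hT (inferInstanceAs (Mono i))
  obtain ⟨e, -, -⟩ := exists_iso_binaryBiproduct_of_distTriang _ hT hd
  exact genWindow_of_biprod (genWindow_iso hY e)

lemma HasFiniteSupport.of_mem_genWindow [HasCoproducts.{v} 𝒯] {G : 𝒯} (hG : HasFiniteSupport G)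
    {m n : ℤ} {X : 𝒯} (hX : X ∈ genWindow G m n) : HasFiniteSupport X := by
  refine hX {X | HasFiniteSupport X} ⟨fun i _ _ => hG.shift i,
    fun X Y hX e => hX.of_retract e.inv e.hom e.inv_hom_id,
    fun Tr hTr h₁ h₃ => HasFiniteSupport.of_distTriang hTr h₁ h₃,
    fun X Y hX hY => ?_,
    fun X Y h => HasFiniteSupport.of_retract h biprod.inl biprod.fst (by simp)⟩
  exact HasFiniteSupport.of_distTriang (binaryBiproductTriangle_distinguished X Y) hX hY

/-- The morphism `f` factors through an object built from finitely many shifts of `G`. -/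
def FactorsThroughWindow (G : 𝒯) {C X : 𝒯} (f : C ⟶ X) : Prop :=
  ∃ (M : ℤ) (P : 𝒯) (_ : P ∈ genWindow G (-M) M) (a : C ⟶ P) (b : P ⟶ X), a ≫ b = f

lemma FactorsThroughWindow.comp {G C X Y : 𝒯} {f : C ⟶ X} (hf : FactorsThroughWindow G f)
    (g : X ⟶ Y) : FactorsThroughWindow G (f ≫ g) := by
  obtain ⟨M, P, hP, a, b, rfl⟩ := hf
  exact ⟨M, P, hP, a, b ≫ g, by simp⟩

lemma FactorsThroughWindow.add {G C X : 𝒯} {f g : C ⟶ X} (hf : FactorsThroughWindow G f)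
    (hg : FactorsThroughWindow G g) : FactorsThroughWindow G (f + g) := by
  obtain ⟨M, P, hP, a, b, rfl⟩ := hf
  obtain ⟨N, Q, hQ, c, d, rfl⟩ := hg
  exact ⟨max M N, P ⊞ Q, genWindow_biprod
    (genWindow_mono G (neg_le_neg (le_max_left M N)) (le_max_left M N) hP)
    (genWindow_mono G (neg_le_neg (le_max_right M N)) (le_max_right M N) hQ),
    biprod.lift a c, biprod.desc b d, by simp⟩

lemma FactorsThroughWindow.zero (G C X : 𝒯) : FactorsThroughWindow G (0 : C ⟶ X) :=
  ⟨0, _, genWindow_shift G (i := 0) (by simp) (by simp), 0, 0, by simp⟩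

lemma FactorsThroughWindow.sum {G C X : 𝒯} {ι : Type*} (s : Finset ι) (f : ι → (C ⟶ X))
    (hf : ∀ i, FactorsThroughWindow G (f i)) : FactorsThroughWindow G (∑ i ∈ s, f i) :=
  Finset.sum_induction f (FactorsThroughWindow G) (fun _ _ => .add) (.zero G C X)
    fun i _ => hf i

variable [HasCoproducts.{v} 𝒯]

lemma factorsThroughWindow_of_distTriang {G : 𝒯} (hG : HasFiniteSupport G) {Tr : Triangle 𝒯}
    (hTr : Tr ∈ distTriang 𝒯)
    (h₁ : ∀ (C : 𝒯), HasFiniteSupport C → ∀ f : C ⟶ Tr.obj₁, FactorsThroughWindow G f)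
    (h₃ : ∀ (C : 𝒯), HasFiniteSupport C → ∀ f : C ⟶ Tr.obj₃, FactorsThroughWindow G f)
    (C : 𝒯) (hC : HasFiniteSupport C) (f : C ⟶ Tr.obj₂) : FactorsThroughWindow G f := by
  obtain ⟨M, P, hP, a, b, hab⟩ := h₃ C hC (f ≫ Tr.mor₂)
  obtain ⟨D, u, δ, hD⟩ := distinguished_cocone_triangle₁ a
  have hDs : HasFiniteSupport D :=
    HasFiniteSupport.of_distTriang (inv_rot_of_distTriang _ hD)
      ((hG.of_mem_genWindow hP).shift (-1)) hC
  obtain ⟨k, hk₁, hk₃⟩ := complete_distinguished_triangle_morphism₁ _ _ hD hTr f b hab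
  obtain ⟨N, Q, hQ, c, d, rfl⟩ := h₁ D hDs k
  -- `E` is an extension of `P` by `Q`, obtained by pushing out along `c`.
  obtain ⟨E, i, p, hE⟩ := distinguished_cocone_triangle₂ (δ ≫ c⟦(1 : ℤ)⟧')
  obtain ⟨g, hg, -⟩ := complete_distinguished_triangle_morphism₂ _ _ hD hE c (𝟙 P) (by
    exact (Category.id_comp _).symm)
  obtain ⟨h, hh, -⟩ := complete_distinguished_triangle_morphism₂ _ _ hE hTr d b (by
    exact (Category.assoc _ _ _).trans ((δ ≫= (Functor.map_comp _ c d).symm).trans hk₃))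
  change C ⟶ E at g
  change E ⟶ Tr.obj₂ at h
  change u ≫ f = (c ≫ d) ≫ Tr.mor₁ at hk₁
  change u ≫ g = c ≫ i at hg
  change i ≫ h = d ≫ Tr.mor₁ at hh
  -- `f - g ≫ h` vanishes on `D`, hence factors through `P`.
  obtain ⟨l, hl⟩ := Triangle.yoneda_exact₂ _ hD (f - g ≫ h) (by
    change u ≫ (f - g ≫ h) = 0
    rw [Preadditive.comp_sub, hk₁, reassoc_of% hg, hh, Category.assoc, sub_self])
  change P ⟶ Tr.obj₂ at l
  change f - g ≫ h = a ≫ l at hl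
  have hEw : E ∈ genWindow G (-(max M N)) (max M N) := genWindow_ext hE
    (genWindow_mono G (neg_le_neg (le_max_right M N)) (le_max_right M N) hQ)
    (genWindow_mono G (neg_le_neg (le_max_left M N)) (le_max_left M N) hP)
  have hf : f = g ≫ h + a ≫ l := by rw [← hl]; abel
  rw [hf]
  exact .add ⟨_, E, hEw, g, h, rfl⟩ ⟨M, P, hP, a, l, rfl⟩

lemma factorsThroughWindow_sigma {G : 𝒯} {ι : Type v} (X : ι → 𝒯)
    (hX : ∀ i, ∀ (C : 𝒯), HasFiniteSupport C → ∀ f : C ⟶ X i, FactorsThroughWindow G f)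
    (C : 𝒯) (hC : HasFiniteSupport C) (f : C ⟶ ∐ X) : FactorsThroughWindow G f := by
  classical
  obtain ⟨s, hs⟩ := hC ι X f
  have hsum : sigmaTruncation X s = ∑ i ∈ s, Sigma.π X i ≫ Sigma.ι X i := by
    refine Sigma.hom_ext _ _ fun j => ?_
    rw [ι_sigmaTruncation, Preadditive.comp_sum]
    have h (i : ι) : Sigma.ι X j ≫ Sigma.π X i ≫ Sigma.ι X i =
        if j = i then Sigma.ι X j else 0 := by
      split_ifs with hij
      · subst hij
        simp
      · simp [Sigma.ι_π_of_ne_assoc X hij]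
    simp [h]
  rw [← hs, hsum, Preadditive.comp_sum]
  refine .sum s _ fun i => ?_
  rw [← Category.assoc]
  exact (hX i C hC _).comp _

/-- A compact object lies in a finite window of any compact generator. -/
lemma IsCompactGenerator.exists_mem_genWindow {G : 𝒯} (hG : IsCompactGenerator G) {C : 𝒯}
    (hC : IsCompactObject.{v} C) : ∃ M : ℤ, C ∈ genWindow G (-M) M := by
  have key : C ∈ {X : 𝒯 | ∀ (C : 𝒯), HasFiniteSupport C → ∀ f : C ⟶ X,
      FactorsThroughWindow G f} := by
    have hmem : C ∈ genAllCoprod G := hG.2 ▸ Set.mem_univ C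
    refine hmem _ ⟨fun i C _ f => ?_, fun X Y hX e C hC f => ?_,
      fun Tr hTr h₁ h₃ => factorsThroughWindow_of_distTriang hG.1.hasFiniteSupport hTr h₁ h₃,
      fun ι X hX => factorsThroughWindow_sigma X hX, fun X Y h C hC f => ?_⟩
    · exact ⟨|i|, _, genWindow_shift G (neg_le_neg (le_abs_self i)) (neg_le_abs i), f, 𝟙 _,
        by simp⟩
    · simpa using (hX C hC (f ≫ e.inv)).comp e.hom
    · simpa using (h C hC (f ≫ biprod.inl)).comp biprod.fst
  obtain ⟨M, P, hP, a, b, hab⟩ := key C hC.hasFiniteSupport (𝟙 C)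
  exact ⟨M, genWindow_of_retract hP a b hab⟩

end CompactGeneration

/-- If `G₁` and `G₂` are two compact generators of `T`, there is a positive integer `M` with
`G₁ ∈ ⟨G₂⟩^{(-M,M)}` and `G₂ ∈ ⟨G₁⟩^{(-M,M)}`. -/
theorem stmt14 (G₁ G₂ : T) (h₁ : IsCompactGenerator G₁) (h₂ : IsCompactGenerator G₂) :
    ∃ M : ℤ, 0 < M ∧ G₁ ∈ genWindow G₂ (-M) M ∧ G₂ ∈ genWindow G₁ (-M) M := by
  obtain ⟨M, hM⟩ := h₂.exists_mem_genWindow h₁.1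
  obtain ⟨N, hN⟩ := h₁.exists_mem_genWindow h₂.1
  have hMK : M ≤ max 1 (max M N) := (le_max_left M N).trans (le_max_right _ _)
  have hNK : N ≤ max 1 (max M N) := (le_max_right M N).trans (le_max_right _ _)
  exact ⟨max 1 (max M N), by simp, genWindow_mono G₂ (neg_le_neg hMK) hMK hM,
    genWindow_mono G₁ (neg_le_neg hNK) hNK hN⟩
end

section
/- If T is weakly approximable with approximation data (G, τ, A), then for every F ∈ T^{≤0} and every integer m > 0 there exists a distinguished triangle E_m → F → D_m with E_m ∈ ⟨G⟩^{(1-m-A, A)}_{coproducts} and D_m ∈ T^{≤ -m}. -/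
open CategoryTheory CategoryTheory.Limits CategoryTheory.Pretriangulated

universe w v u

open CategoryTheory CategoryTheory.Limits CategoryTheory.Pretriangulated


variable (T : Type u) [Category.{v} T] [Preadditive T] [HasZeroObject T] [HasShift T ℤ]
  [∀ n : ℤ, (shiftFunctor T n).Additive] [Pretriangulated T]

/-- A t-structure on a triangulated category `T`: a pair of strictly full subcategories
`(T^{≤0}, T^{≥1})` such that `T^{≤0}[1] ⊆ T^{≤0}`, `T^{≥1}[-1] ⊆ T^{≥1}`,
`Hom(T^{≤0}, T^{≥1}) = 0`, and every object `B` sits in a distinguished triangle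
`A ⟶ B ⟶ C ⟶ A[1]` with `A ∈ T^{≤0}` and `C ∈ T^{≥1}`. -/
structure TStructure where
  le : Set T
  ge : Set T
  le_iso : ∀ ⦃A B : T⦄, A ∈ le → (A ≅ B) → B ∈ le
  ge_iso : ∀ ⦃A B : T⦄, A ∈ ge → (A ≅ B) → B ∈ ge
  shift_le : ∀ ⦃A : T⦄, A ∈ le → A⟦(1 : ℤ)⟧ ∈ le
  shift_ge : ∀ ⦃A : T⦄, A ∈ ge → A⟦(-1 : ℤ)⟧ ∈ ge
  hom_zero : ∀ ⦃A B : T⦄ (f : A ⟶ B), A ∈ le → B ∈ ge → f = 0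
  exists_triangle : ∀ B : T, ∃ (A C : T) (f : A ⟶ B) (g : B ⟶ C) (h : C ⟶ A⟦(1 : ℤ)⟧),
    Triangle.mk f g h ∈ (distTriang T) ∧ A ∈ le ∧ C ∈ ge

variable {T}

/-- `T^{≤n} := T^{≤0}⟦-n⟧`; equivalently `X ∈ T^{≤n}` iff `X⟦n⟧ ∈ T^{≤0}`. -/
def TStructure.leN (t : TStructure T) (n : ℤ) : Set T := {X : T | X⟦n⟧ ∈ t.le}

/-- `T^{≥n} := T^{≥1}⟦-n+1⟧`; equivalently `X ∈ T^{≥n}` iff `X⟦n - 1⟧ ∈ T^{≥1}`. -/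
def TStructure.geN (t : TStructure T) (n : ℤ) : Set T := {X : T | X⟦n - 1⟧ ∈ t.ge}

variable [HasCoproducts.{v} T] [HasBinaryBiproducts T]

/-- `⟨G⟩^{(m,n)}` with coproducts: the smallest strictly full subcategory containing `G[i]`
for `m ≤ -i ≤ n`, closed under extensions, small coproducts and direct summands. -/
def coprodWindow (G : T) (m n : ℤ) : Set T :=
  ⋂₀ {S : Set T |
    (∀ i : ℤ, m ≤ -i → -i ≤ n → G⟦i⟧ ∈ S) ∧
    (∀ X Y : T, X ∈ S → (X ≅ Y) → Y ∈ S) ∧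
    (∀ Tr : Triangle T, Tr ∈ (distTriang T) → Tr.obj₁ ∈ S → Tr.obj₃ ∈ S → Tr.obj₂ ∈ S) ∧
    (∀ (ι : Type v) (X : ι → T), (∀ i, X i ∈ S) → (∐ X) ∈ S) ∧
    (∀ X Y : T, (X ⊞ Y) ∈ S → X ∈ S)}

section Approximation

variable {T : Type u} [Category.{v} T] [Preadditive T] [HasZeroObject T] [HasShift T ℤ]
  [∀ n : ℤ, (shiftFunctor T n).Additive] [Pretriangulated T]

/-- Replacing the middle object of a distinguished triangle by an isomorphic one. -/
lemma distinguished_of_iso_obj₂ {S : Triangle T} (hS : S ∈ distTriang T) {F : T}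
    (e : S.obj₂ ≅ F) : Triangle.mk (S.mor₁ ≫ e.hom) (e.inv ≫ S.mor₂) S.mor₃ ∈ distTriang T :=
  isomorphic_distinguished _ hS _ (Triangle.isoMk _ _ (Iso.refl _) e.symm (Iso.refl _)
    (show (S.mor₁ ≫ e.hom) ≫ e.inv = 𝟙 _ ≫ S.mor₁ by simp)
    (show (e.inv ≫ S.mor₂) ≫ 𝟙 _ = e.inv ≫ S.mor₂ by simp)
    (show S.mor₃ ≫ (𝟙 S.obj₁)⟦(1 : ℤ)⟧' = 𝟙 _ ≫ S.mor₃ by simp))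

/-- If the cone of `E ⟶ F` is `D` and the cone of `E' ⟶ D` is `D'`, then some extension `E''` of
`E'` by `E` maps to `F` with cone left orthogonal to every object to which `D'` is. This is a
substitute for the octahedral axiom. -/
lemma exists_extension_orthogonal_cone {E F D E' D' : T}
    {f : E ⟶ F} {g : F ⟶ D} {h : D ⟶ E⟦(1 : ℤ)⟧} {p : E' ⟶ D} {q : D ⟶ D'}
    {r : D' ⟶ E'⟦(1 : ℤ)⟧} (hT : Triangle.mk f g h ∈ distTriang T)
    (hT' : Triangle.mk p q r ∈ distTriang T) :
    ∃ (E'' : T) (i : E ⟶ E'') (j : E'' ⟶ E') (k : E' ⟶ E⟦(1 : ℤ)⟧)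
      (C : T) (a : E'' ⟶ F) (b : F ⟶ C) (c : C ⟶ E''⟦(1 : ℤ)⟧),
      Triangle.mk i j k ∈ distTriang T ∧ Triangle.mk a b c ∈ distTriang T ∧
      ∀ Y : T, Subsingleton (D' ⟶ Y) → Subsingleton (C ⟶ Y) := by
  obtain ⟨E'', i, j, hE⟩ := distinguished_cocone_triangle₂ (p ≫ h)
  obtain ⟨a, ha₁, ha₂⟩ : ∃ a : E'' ⟶ F, i ≫ a = f ∧ j ≫ p = a ≫ g := by
    have comm : (p ≫ h) ≫ (𝟙 E)⟦(1 : ℤ)⟧' = p ≫ h := by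
      simp
    obtain ⟨a, ha₁, ha₂⟩ := complete_distinguished_triangle_morphism₂ _ _ hE hT (𝟙 E) p comm
    exact ⟨a, ha₁.trans (Category.id_comp f), ha₂⟩
  obtain ⟨C, b, c, hC⟩ := distinguished_cocone_triangle a
  refine ⟨E'', i, j, p ≫ h, C, a, b, c, hE, hC, fun Y hY ↦ ?_⟩
  have hp : ∀ ψ : D ⟶ Y, p ≫ ψ = 0 → ψ = 0 := fun ψ hψ ↦ by
    obtain ⟨θ, rfl⟩ := Triangle.yoneda_exact₂ _ hT' ψ hψ
    obtain rfl : θ = 0 := hY.elim _ _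
    exact comp_zero
  have hinj : ∀ φ : F ⟶ Y, a ≫ φ = 0 → φ = 0 := fun φ hφ ↦ by
    obtain ⟨ψ, rfl⟩ := Triangle.yoneda_exact₂ _ hT φ
      (show f ≫ φ = 0 by rw [← ha₁, Category.assoc, hφ, comp_zero])
    change D ⟶ Y at ψ
    change a ≫ g ≫ ψ = 0 at hφ
    obtain ⟨χ, hχ⟩ := Triangle.yoneda_exact₃ _ hE (p ≫ ψ)
      (show j ≫ p ≫ ψ = 0 by rw [reassoc_of% ha₂, hφ])
    change E⟦(1 : ℤ)⟧ ⟶ Y at χ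
    change p ≫ ψ = (p ≫ h) ≫ χ at hχ
    have hψ : ψ = h ≫ χ := sub_eq_zero.1 (hp _ (by
      rw [Preadditive.comp_sub, hχ, Category.assoc, sub_self]))
    have hgh : g ≫ h = 0 := comp_distTriang_mor_zero₂₃ _ hT
    change g ≫ ψ = 0
    rw [hψ, reassoc_of% hgh, zero_comp]
  have hsurj : ∀ α : E''⟦(1 : ℤ)⟧ ⟶ Y, ∃ γ : F⟦(1 : ℤ)⟧ ⟶ Y, α = a⟦(1 : ℤ)⟧' ≫ γ := fun α ↦ by
    have hki : (p ≫ h) ≫ i⟦(1 : ℤ)⟧' = 0 := comp_distTriang_mor_zero₃₁ _ hE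
    have hhi : h ≫ i⟦(1 : ℤ)⟧' ≫ α = 0 := hp _ (by
      rw [← Category.assoc, ← Category.assoc, hki, zero_comp])
    obtain ⟨γ, hγ⟩ := Triangle.yoneda_exact₃ _ (rot_of_distTriang _ hT) (i⟦(1 : ℤ)⟧' ≫ α) hhi
    change F⟦(1 : ℤ)⟧ ⟶ Y at γ
    change i⟦(1 : ℤ)⟧' ≫ α = (-f⟦(1 : ℤ)⟧') ≫ γ at hγ
    obtain ⟨ε, hε⟩ := Triangle.yoneda_exact₃ _
      (rot_of_distTriang _ (rot_of_distTriang _ hE)) (α + a⟦(1 : ℤ)⟧' ≫ γ)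
      (show (-i⟦(1 : ℤ)⟧') ≫ (α + a⟦(1 : ℤ)⟧' ≫ γ) = 0 by
        rw [Preadditive.neg_comp, Preadditive.comp_add, hγ, ← Category.assoc, ← Functor.map_comp,
          ha₁]
        simp)
    change E'⟦(1 : ℤ)⟧ ⟶ Y at ε
    change α + a⟦(1 : ℤ)⟧' ≫ γ = (-j⟦(1 : ℤ)⟧') ≫ ε at hε
    obtain ⟨ζ, hζ⟩ := Triangle.yoneda_exact₂ _
      (rot_of_distTriang _ (rot_of_distTriang _ hT')) ε (hY.elim _ _)
    change D⟦(1 : ℤ)⟧ ⟶ Y at ζ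
    change ε = (-p⟦(1 : ℤ)⟧') ≫ ζ at hζ
    refine ⟨g⟦(1 : ℤ)⟧' ≫ ζ - γ, ?_⟩
    rw [Preadditive.comp_sub, ← Functor.map_comp_assoc, ← ha₂, eq_sub_iff_add_eq, hε, hζ]
    simp
  have hzero : ∀ u : C ⟶ Y, u = 0 := fun u ↦ by
    obtain ⟨α, rfl⟩ := Triangle.yoneda_exact₃ _ hC u (hinj _ (by
      have hab : a ≫ b = 0 := comp_distTriang_mor_zero₁₂ _ hC
      change a ≫ b ≫ u = 0
      rw [reassoc_of% hab, zero_comp]))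
    obtain ⟨γ, hγ⟩ := hsurj α
    have hca : c ≫ a⟦(1 : ℤ)⟧' = 0 := comp_distTriang_mor_zero₃₁ _ hC
    change c ≫ α = 0
    rw [hγ, reassoc_of% hca, zero_comp]
  exact ⟨fun u v ↦ (hzero u).trans (hzero v).symm⟩

namespace TStructure

/-- The aisle contains the left orthogonal of the coaisle. -/
lemma mem_le_of_subsingleton_hom (t : TStructure T) {X : T}
    (hX : ∀ Y ∈ t.ge, Subsingleton (X ⟶ Y)) : X ∈ t.le := by
  obtain ⟨A, C, f, g, h, hT, hA, hC⟩ := t.exists_triangle X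
  have hg : g = 0 := (hX C hC).elim _ _
  obtain ⟨s, hs⟩ : ∃ s : A⟦(1 : ℤ)⟧ ⟶ C, 𝟙 C = h ≫ s :=
    Triangle.yoneda_exact₃ _ hT (𝟙 C) (show g ≫ 𝟙 C = 0 by rw [hg, zero_comp])
  have hs₀ : s = 0 := t.hom_zero s (t.shift_le hA) hC
  have hC₀ : IsZero C := (IsZero.iff_id_eq_zero C).2 (by rw [hs, hs₀, comp_zero])
  have : IsIso f := (Triangle.isZero₃_iff_isIso₁ _ hT).1 hC₀
  exact t.le_iso hA (asIso f)

lemma mem_leN_of_subsingleton_hom (t : TStructure T) {n : ℤ} {X D : T} (hD : D ∈ t.leN n)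
    (hX : ∀ Y : T, Subsingleton (D ⟶ Y) → Subsingleton (X ⟶ Y)) : X ∈ t.leN n := by
  refine t.mem_le_of_subsingleton_hom fun Y hY ↦ ?_
  have e (Z : T) := (shiftEquiv T n).toAdjunction.homEquiv Z Y
  have : Subsingleton (D⟦n⟧ ⟶ Y) :=
    ⟨fun u v ↦ (t.hom_zero u hD hY).trans (t.hom_zero v hD hY).symm⟩
  have : Subsingleton ((shiftEquiv T n).functor.obj D ⟶ Y) := this
  have := hX _ (e D).symm.subsingleton
  exact (e X).subsingleton

end TStructure

end Approximation

section Window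

lemma coprodWindow_mono (G : T) {m n m' n' : ℤ} (hm : m' ≤ m) (hn : n ≤ n') :
    coprodWindow G m n ⊆ coprodWindow G m' n' :=
  Set.sInter_subset_sInter fun _ ⟨h, hS⟩ ↦
    ⟨fun i h₁ h₂ ↦ h i (hm.trans h₁) (h₂.trans hn), hS⟩

lemma coprodWindow_extension (G : T) {m n : ℤ} {Tr : Triangle T} (hT : Tr ∈ distTriang T)
    (h₁ : Tr.obj₁ ∈ coprodWindow G m n) (h₃ : Tr.obj₃ ∈ coprodWindow G m n) :
    Tr.obj₂ ∈ coprodWindow G m n :=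
  fun S hS ↦ hS.2.2.1 Tr hT (h₁ S hS) (h₃ S hS)

lemma shift_mem_coprodWindow (G : T) {m n : ℤ} {X : T} (hX : X ∈ coprodWindow G m n) (k : ℤ) :
    X⟦k⟧ ∈ coprodWindow G (m - k) (n - k) := by
  rintro S ⟨hG, hiso, hext, hcop, hsum⟩
  refine hX {Y | Y⟦k⟧ ∈ S} ⟨fun i h₁ h₂ ↦ ?_, fun Y Z hY e ↦ ?_, fun Tr hT h₁ h₃ ↦ ?_,
    fun ι Y hY ↦ ?_, fun Y Z hYZ ↦ ?_⟩
  · exact hiso _ _ (hG (i + k) (by lia) (by lia)) ((shiftFunctorAdd T i k).app G)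
  · exact hiso _ _ hY ((shiftFunctor T k).mapIso e)
  · exact hext _ (Triangle.shift_distinguished Tr hT k) h₁ h₃
  · exact hiso _ _ (hcop ι _ hY) (PreservesCoproduct.iso (shiftFunctor T k) Y).symm
  · have := preservesBinaryBiproducts_of_preservesBiproducts (shiftFunctor T k)
    exact hsum _ (Z⟦k⟧) (hiso _ _ hYZ ((shiftFunctor T k).mapBiprod Y Z))

end Window

/-- Approximations of objects of the aisle can be shifted to objects of `T^{≤-n}`. -/
lemma exists_approximation_of_mem_leN {G : T} {t : TStructure T} {A : ℤ}
    (happrox : ∀ F ∈ t.le, ∃ (E D : T) (f : E ⟶ F) (g : F ⟶ D) (h : D ⟶ E⟦(1 : ℤ)⟧),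
      Triangle.mk f g h ∈ (distTriang T) ∧ E ∈ coprodWindow G (-A) A ∧ D ∈ t.leN (-1))
    {n : ℤ} {F : T} (hF : F ∈ t.leN (-n)) :
    ∃ (E D : T) (f : E ⟶ F) (g : F ⟶ D) (h : D ⟶ E⟦(1 : ℤ)⟧),
      Triangle.mk f g h ∈ (distTriang T) ∧ E ∈ coprodWindow G (-A - n) (A - n) ∧
        D ∈ t.leN (-(n + 1)) := by
  obtain ⟨E, D, f, g, h, hT, hE, hD⟩ := happrox _ hF
  let e : F⟦-n⟧⟦n⟧ ≅ F := (shiftFunctorCompIsoId T (-n) n (by lia)).app F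
  let S := (shiftFunctor (Triangle T) n).obj (Triangle.mk f g h)
  have hS : S ∈ distTriang T := Triangle.shift_distinguished _ hT n
  refine ⟨E⟦n⟧, D⟦n⟧, S.mor₁ ≫ e.hom, e.inv ≫ S.mor₂, S.mor₃,
    distinguished_of_iso_obj₂ hS e, shift_mem_coprodWindow G hE n,
    t.le_iso hD ((shiftFunctorAdd' T n (-(n + 1)) (-1) (by lia)).app D)⟩

/-- If `(G, τ, A)` is weak approximation data for `T`, then for every `F ∈ T^{≤0}` and every
`m > 0` there is a distinguished triangle `E_m ⟶ F ⟶ D_m` with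
`E_m ∈ ⟨G⟩^{(1-m-A, A)}` (with coproducts) and `D_m ∈ T^{≤-m}`. -/
theorem stmt16 (G : T) (t : TStructure T) (A : ℤ) (hApos : 0 < A)
    (hcpt : IsCompactObject.{v} G) (hgen : genAllCoprod G = Set.univ)
    (hGle : G ∈ t.leN A)
    (hGvan : ∀ X ∈ t.leN (-A), ∀ f : G ⟶ X, f = 0)
    (happrox : ∀ F ∈ t.le, ∃ (E D : T) (f : E ⟶ F) (g : F ⟶ D) (h : D ⟶ E⟦(1 : ℤ)⟧),
      Triangle.mk f g h ∈ (distTriang T) ∧ E ∈ coprodWindow G (-A) A ∧ D ∈ t.leN (-1)) :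
    ∀ F ∈ t.le, ∀ m : ℤ, 0 < m →
      ∃ (E D : T) (f : E ⟶ F) (g : F ⟶ D) (h : D ⟶ E⟦(1 : ℤ)⟧),
        Triangle.mk f g h ∈ (distTriang T) ∧
        E ∈ coprodWindow G (1 - m - A) A ∧ D ∈ t.leN (-m) := by
  intro F hF m hm
  induction m, hm using Int.leInduction with
  | base =>
    obtain ⟨E, D, f, g, h, hT, hE, hD⟩ := happrox F hF
    exact ⟨E, D, f, g, h, hT, coprodWindow_mono G (by lia) le_rfl hE, hD⟩
  | succ m hm ih =>
    have hm₀ : 0 < m := hm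
    obtain ⟨E, D, f, g, h, hT, hE, hD⟩ := ih
    obtain ⟨E', D', p, q, r, hT', hE', hD'⟩ := exists_approximation_of_mem_leN happrox hD
    obtain ⟨E'', i, j, k, C, a, b, c, hE'', hC, horth⟩ :=
      exists_extension_orthogonal_cone hT hT'
    exact ⟨E'', C, a, b, c, hC,
      coprodWindow_extension G hE'' (coprodWindow_mono G (by lia) le_rfl hE)
        (coprodWindow_mono G (by lia) (by lia) hE'),
      t.mem_leN_of_subsingleton_hom hD' horth⟩
end
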